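/- Let A be a countable alphabet, P a probability distribution on A, and D a proper and almost surely complete dictionary over A. Then for every positive integer m the sandwich inequalities ∑_{α∈D, |α|<m} P(α)|α| ≤ l̄(D_m) ≤ l̄(D) hold, and consequently lim_{m→∞} l̄(D_m) = l̄(D), where l̄(E) = ∑_{α∈E} P(α)|α| (sums in [0,∞]) and D_m = {α ∈ D : |α| < m} ∪ {α ∈ D : |α| = m} ∪ T_m with T_m = {α ∈ A^m : no β ∈ D is a prefix of α}. -/

import Mathlib

open scoped ENNReal
open Filter

/-- The probability of a finite string, obtained by extending the
distribution `P` multiplicatively: `P(a₁⋯aₙ) = ∏ᵢ P(aᵢ)`. -/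
noncomputable def strProb {A : Type*} (P : PMF A) (l : List A) : ℝ≥0∞ :=
  (l.map fun a => P a).prod

/-- A dictionary is a set of nonempty finite strings. -/
def IsDictionary {A : Type*} (D : Set (List A)) : Prop :=
  ∀ α ∈ D, α ≠ []

/-- A dictionary is proper if no string in it is a (proper) prefix of
another string in it. -/
def IsProper {A : Type*} (D : Set (List A)) : Prop :=
  ∀ α ∈ D, ∀ β ∈ D, α <+: β → α = β

/-- A dictionary is complete if every infinite sequence over `A` has a
prefix in it. -/
def IsCompleteDict {A : Type*} (D : Set (List A)) : Prop :=
  ∀ x : ℕ → A, ∃ α ∈ D, α = (List.range α.length).map x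

/-- The probability that the length-`n` prefix of a random infinite sequence
has some prefix belonging to `D`. -/
noncomputable def prefixProb {A : Type*} (P : PMF A) (D : Set (List A)) (n : ℕ) : ℝ≥0∞ :=
  ∑' γ : {γ : List A // γ.length = n ∧ ∃ β ∈ D, β <+: γ}, strProb P γ

/-- `D` is almost surely complete: under the infinite product measure `P^ℕ`,
the event that an infinite sequence has a prefix in `D` has probability `1`.
(By continuity from below, this probability is the limit, as `n → ∞`, of the
probability that the length-`n` prefix has a prefix in `D`.) -/
def IsASC {A : Type*} (P : PMF A) (D : Set (List A)) : Prop :=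
  Tendsto (prefixProb P D) atTop (nhds 1)

/-- `Tset D n` = strings of length `n` having no prefix in `D`. -/
def Tset {A : Type*} (D : Set (List A)) (n : ℕ) : Set (List A) :=
  {α | α.length = n ∧ ∀ β ∈ D, ¬ β <+: α}

/-- `Dperp D n = {α ∈ D : |α| = n} ∪ Tₙ`. -/
def Dperp {A : Type*} (D : Set (List A)) (n : ℕ) : Set (List A) :=
  {α ∈ D | α.length = n} ∪ Tset D n

/-- `Dn D n = {α ∈ D : |α| < n} ∪ Dₙ^⊥`. -/
def Dn {A : Type*} (D : Set (List A)) (n : ℕ) : Set (List A) :=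
  {α ∈ D | α.length < n} ∪ Dperp D n

/-- The one-letter extensions `αA = {αa : a ∈ A}` of a string `α`. -/
def oneExt {A : Type*} (α : List A) : Set (List A) :=
  {l | ∃ a : A, l = α ++ [a]}

/-- The extension `D[α] = (D \ {α}) ∪ αA` of a dictionary at `α`. -/
def extendDict {A : Type*} (D : Set (List A)) (α : List A) : Set (List A) :=
  (D \ {α}) ∪ oneExt α

/-- The nonnegative entropy contribution `-p log₂ p ∈ [0,∞]` of a
probability value `p`. -/
noncomputable def entTerm (p : ℝ≥0∞) : ℝ≥0∞ :=
  ENNReal.ofReal (-(p.toReal * Real.logb 2 p.toReal))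

/-- The entropy `H(E) = -∑_{α∈E} P(α) log₂ P(α)` of a dictionary, in `[0,∞]`. -/
noncomputable def dictEntropy {A : Type*} (P : PMF A) (E : Set (List A)) : ℝ≥0∞ :=
  ∑' α : E, entTerm (strProb P α)

/-- The average length `l̄(E) = ∑_{α∈E} P(α)|α|` of a dictionary, in `[0,∞]`. -/
noncomputable def avgLen {A : Type*} (P : PMF A) (E : Set (List A)) : ℝ≥0∞ :=
  ∑' α : E, strProb P α * (α : List A).length

/-- The source entropy `H(P) = -∑_{a∈A} P(a) log₂ P(a)`, in `[0,∞]`. -/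
noncomputable def srcEntropy {A : Type*} (P : PMF A) : ℝ≥0∞ :=
  ∑' a : A, entTerm (P a)

lemma strProb_append {A : Type*} (P : PMF A) (α β : List A) :
    strProb P (α ++ β) = strProb P α * strProb P β := by
  simp [strProb]

lemma tsum_strProb_length_eq {A : Type*} (P : PMF A) (n : ℕ) :
    ∑' γ : {γ : List A | γ.length = n}, strProb P γ = 1 := by
  induction n with
  | zero =>
    have h : {γ : List A | γ.length = 0} = {[]} := by ext; simp
    rw [h, tsum_singleton]
    simp [strProb]
  | succ n ih =>
    let e : A × {γ : List A | γ.length = n} → {γ : List A | γ.length = n + 1} :=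
      fun p => ⟨p.1 :: p.2.1, congrArg (· + 1) p.2.2⟩
    have he : Function.Bijective e := by
      constructor
      · rintro ⟨a, γ, hγ⟩ ⟨b, δ, hδ⟩ h
        simpa [e] using h
      · rintro ⟨γ, hγ⟩
        obtain _ | ⟨a, γ⟩ := γ
        · simp at hγ
        · exact ⟨(a, ⟨γ, by simpa using hγ⟩), rfl⟩
    rw [← (Equiv.ofBijective e he).tsum_eq, ENNReal.tsum_prod']
    calc ∑' a, ∑' γ : {γ : List A | γ.length = n}, strProb P (a :: γ.1)
        = ∑' a, P a * ∑' γ : {γ : List A | γ.length = n}, strProb P γ := by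
          simp [strProb, ENNReal.tsum_mul_left]
      _ = 1 := by simp only [ih, mul_one, P.tsum_coe]

lemma tsum_strProb_extensions {A : Type*} (P : PMF A) (α : List A) {n : ℕ}
    (hn : α.length ≤ n) :
    ∑' γ : {γ : List A | γ.length = n ∧ α <+: γ}, strProb P γ = strProb P α := by
  obtain ⟨k, rfl⟩ := Nat.exists_eq_add_of_le hn
  let e : {δ : List A | δ.length = k} →
      {γ : List A | γ.length = α.length + k ∧ α <+: γ} :=
    fun δ => ⟨α ++ δ.1, List.length_append.trans (congrArg (α.length + ·) δ.2),
      List.prefix_append _ _⟩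
  have he : Function.Bijective e := by
    constructor
    · rintro ⟨γ, hγ⟩ ⟨δ, hδ⟩ h
      simpa [e] using h
    · rintro ⟨_, hγ, δ, rfl⟩
      exact ⟨⟨δ, by simpa using hγ⟩, rfl⟩
  rw [← (Equiv.ofBijective e he).tsum_eq]
  simp [e, strProb_append, ENNReal.tsum_mul_left, tsum_strProb_length_eq P k]

lemma tsum_strProb_Tset_add_prefixProb {A : Type*} (P : PMF A) (D : Set (List A)) (n : ℕ) :
    ∑' γ : Tset D n, strProb P γ + prefixProb P D n = 1 := by
  have hd : Disjoint (Tset D n) {γ : List A | γ.length = n ∧ ∃ β ∈ D, β <+: γ} := by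
    rw [Set.disjoint_left]
    rintro γ ⟨_, h⟩ ⟨_, β, hβ, hp⟩
    exact h β hβ hp
  have hu : Tset D n ∪ {γ : List A | γ.length = n ∧ ∃ β ∈ D, β <+: γ} =
      {γ : List A | γ.length = n} := by
    ext γ
    simp only [Tset, Set.mem_union, Set.mem_ofPred_eq]
    grind
  have h := ENNReal.summable.tsum_union_disjoint (f := strProb P) hd ENNReal.summable
  rw [hu, tsum_strProb_length_eq] at h
  exact h.symm

/-- Extending the strings of `Tset D m` to length `n` yields strings that either still have
no prefix in `D` or acquired one of length greater than `m`. -/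
lemma tsum_strProb_Tset_le_add {A : Type*} (P : PMF A) (D : Set (List A)) {m n : ℕ}
    (hmn : m ≤ n) :
    ∑' α : Tset D m, strProb P α ≤
      ∑' γ : Tset D n, strProb P γ + ∑' α : {α ∈ D | m < α.length}, strProb P α := by
  let E : Set (List A) := {γ | γ.length = n ∧ ∃ α ∈ Tset D m, α <+: γ}
  let L : Set (List A) := {α | α ∈ D ∧ m < α.length ∧ α.length ≤ n}
  let X : List A → Set (List A) := fun α => {γ | γ.length = n ∧ α <+: γ}
  have hE : E ⊆ Tset D n ∪ ⋃ α ∈ L, X α := by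
    rintro γ ⟨hγ, α, ⟨hα, hαD⟩, hp⟩
    by_cases h : ∃ β ∈ D, β <+: γ
    · obtain ⟨β, hβ, hβγ⟩ := h
      right
      simp only [Set.mem_iUnion]
      refine ⟨β, ⟨hβ, ?_, hγ ▸ hβγ.length_le⟩, hγ, hβγ⟩
      by_contra! hle
      exact hαD β hβ (List.prefix_of_prefix_length_le hβγ hp (hα ▸ hle))
    · exact Or.inl ⟨hγ, fun β hβ hp => h ⟨β, hβ, hp⟩⟩
  calc ∑' α : Tset D m, strProb P α
      = ∑' α : Tset D m, ∑' γ : X α, strProb P γ :=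
        tsum_congr fun α => (tsum_strProb_extensions P α.1 (α.2.1.trans_le hmn)).symm
    _ = ∑' p : Σ α : Tset D m, X α, strProb P p.2 :=
        (ENNReal.tsum_sigma' fun p : Σ α : Tset D m, X α => strProb P p.2).symm
    _ ≤ ∑' γ : E, strProb P γ := by
        let e : (Σ α : Tset D m, X α) → E :=
          fun p => ⟨p.2.1, p.2.2.1, p.1.1, p.1.2, p.2.2.2⟩
        have he : Function.Injective e := by
          rintro ⟨⟨α, hα⟩, γ, hγ⟩ ⟨⟨β, hβ⟩, δ, hδ⟩ h
          obtain rfl : γ = δ := congrArg Subtype.val h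
          obtain rfl : α = β :=
            (List.prefix_of_prefix_length_le hγ.2 hδ.2 (hα.1.trans hβ.1.symm).le).eq_of_length
              (hα.1.trans hβ.1.symm)
          rfl
        exact ENNReal.tsum_comp_le_tsum_of_injective he fun γ : E => strProb P γ
    _ ≤ ∑' γ : ↑(Tset D n ∪ ⋃ α ∈ L, X α), strProb P γ := ENNReal.tsum_mono_subtype _ hE
    _ ≤ ∑' γ : Tset D n, strProb P γ + ∑' γ : ↑(⋃ α ∈ L, X α), strProb P γ :=
        ENNReal.tsum_union_le _ _ _
    _ ≤ ∑' γ : Tset D n, strProb P γ + ∑' α : L, ∑' γ : X α, strProb P γ := by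
        gcongr
        exact ENNReal.tsum_biUnion_le_tsum _ _ _
    _ = ∑' γ : Tset D n, strProb P γ + ∑' α : L, strProb P α := by
        congr 1
        exact tsum_congr fun α => tsum_strProb_extensions P α.1 α.2.2.2
    _ ≤ _ := by
        gcongr
        exact ENNReal.tsum_mono_subtype _ fun α hα => ⟨hα.1, hα.2.1⟩

lemma tsum_strProb_Tset_le {A : Type*} (P : PMF A) {D : Set (List A)} (hasc : IsASC P D)
    (m : ℕ) :
    ∑' α : Tset D m, strProb P α ≤ ∑' α : {α ∈ D | m < α.length}, strProb P α := by
  refine (ENNReal.add_le_add_iff_right ENNReal.one_ne_top).1 (le_of_tendsto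
    (hasc.const_add (∑' α : Tset D m, strProb P α)) ?_)
  filter_upwards [eventually_ge_atTop m] with n hn
  calc ∑' α : Tset D m, strProb P α + prefixProb P D n
      ≤ ∑' γ : Tset D n, strProb P γ + ∑' α : {α ∈ D | m < α.length}, strProb P α
          + prefixProb P D n := by
        gcongr
        exact tsum_strProb_Tset_le_add P D hn
    _ = _ := by rw [add_right_comm, tsum_strProb_Tset_add_prefixProb, add_comm]

lemma avgLen_mono {A : Type*} (P : PMF A) {D E : Set (List A)} (h : D ⊆ E) :
    avgLen P D ≤ avgLen P E :=
  ENNReal.tsum_mono_subtype (fun α => strProb P α * α.length) h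

lemma avgLen_Dn_le {A : Type*} (P : PMF A) {D : Set (List A)} (hasc : IsASC P D) (m : ℕ) :
    avgLen P (Dn D m) ≤ avgLen P D := by
  have hDn : Dn D m = {α ∈ D | α.length ≤ m} ∪ Tset D m := by
    ext α
    simp only [Dn, Dperp, Set.mem_union, Set.mem_ofPred_eq]
    grind
  have hd : Disjoint {α ∈ D | α.length ≤ m} {α ∈ D | m < α.length} := by
    rw [Set.disjoint_left]
    rintro α ⟨_, h⟩ ⟨_, h'⟩
    exact absurd h h'.not_ge
  have hD : {α ∈ D | α.length ≤ m} ∪ {α ∈ D | m < α.length} = D := by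
    ext α
    simp only [Set.mem_union, Set.mem_ofPred_eq]
    grind
  have hT : avgLen P (Tset D m) ≤ avgLen P {α ∈ D | m < α.length} :=
    calc avgLen P (Tset D m) = (∑' α : Tset D m, strProb P α) * m := by
          rw [← ENNReal.tsum_mul_right]
          exact tsum_congr fun α => by rw [α.2.1]
      _ ≤ (∑' α : {α ∈ D | m < α.length}, strProb P α) * m := by
          gcongr
          exact tsum_strProb_Tset_le P hasc m
      _ ≤ avgLen P {α ∈ D | m < α.length} := by
          rw [← ENNReal.tsum_mul_right]
          refine ENNReal.tsum_le_tsum fun α => ?_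
          gcongr
          exact α.2.2.le
  calc avgLen P (Dn D m)
      ≤ avgLen P {α ∈ D | α.length ≤ m} + avgLen P (Tset D m) := by
        rw [hDn]
        exact ENNReal.tsum_union_le (fun α => strProb P α * α.length) _ _
    _ ≤ avgLen P {α ∈ D | α.length ≤ m} + avgLen P {α ∈ D | m < α.length} := by gcongr
    _ = avgLen P D := by
        have h := ENNReal.summable.tsum_union_disjoint
          (f := fun α => strProb P α * α.length) hd ENNReal.summable
        rw [hD] at h
        exact h.symm

lemma tendsto_avgLen_length_lt {A : Type*} (P : PMF A) (D : Set (List A)) :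
    Tendsto (fun m : ℕ => avgLen P {α ∈ D | α.length < m}) atTop (nhds (avgLen P D)) := by
  refine tendsto_order.2 ⟨fun c hc => ?_, fun c hc => Eventually.of_forall fun m =>
    (avgLen_mono P (Set.sep_subset _ _)).trans_lt hc⟩
  let f : List A → ℝ≥0∞ := fun α => strProb P α * α.length
  have hf (E : Set (List A)) : avgLen P E = ∑' α, E.indicator f α := tsum_subtype E f
  rw [hf, ENNReal.tsum_eq_iSup_sum, lt_iSup_iff] at hc
  obtain ⟨s, hs⟩ := hc
  filter_upwards [eventually_gt_atTop (s.sup List.length)] with m hm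
  rw [hf]
  refine (hs.trans_eq (Finset.sum_congr rfl fun α hα => ?_)).trans_le (ENNReal.sum_le_tsum s)
  have hlt : α.length < m := (Finset.le_sup hα).trans_lt hm
  by_cases h : α ∈ D <;> simp [Set.indicator, h, hlt]

/-- If `D` is proper and almost surely complete then, for
every positive integer `m`, `∑_{α∈D,|α|<m} P(α)|α| ≤ l̄(D_m) ≤ l̄(D)`, and
consequently `lim_{m→∞} l̄(D_m) = l̄(D)`. -/
theorem avgLen_Dn_sandwich_and_tendsto {A : Type*} [Countable A] (P : PMF A)
    (D : Set (List A)) (hdict : IsDictionary D) (hprop : IsProper D)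
    (hasc : IsASC P D) :
    (∀ m : ℕ, 0 < m →
      avgLen P {α ∈ D | α.length < m} ≤ avgLen P (Dn D m) ∧
      avgLen P (Dn D m) ≤ avgLen P D) ∧
    Tendsto (fun m : ℕ => avgLen P (Dn D m)) atTop (nhds (avgLen P D)) := by
  have hle (m : ℕ) : avgLen P {α ∈ D | α.length < m} ≤ avgLen P (Dn D m) :=
    avgLen_mono P Set.subset_union_left
  exact ⟨fun m _ => ⟨hle m, avgLen_Dn_le P hasc m⟩,
    tendsto_of_tendsto_of_tendsto_of_le_of_le (tendsto_avgLen_length_lt P D)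
      tendsto_const_nhds hle (avgLen_Dn_le P hasc)⟩
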